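/- Let B > 0 be a fixed constant. There exists a constant c > 0, depending only on B, such that for all d ≥ 2 and all k ≥ 1, with probability at least 1 − c/(d·k) over the random comparison outcomes {W_ij}, the negative log-likelihood ℓ attains a unique minimizer over the set Θ_∞ = {θ ∈ ℝ^d : Σ_i θ_i = 0}; that is, with this probability there exists a unique finite θ̂ ∈ Θ_∞ with ℓ(θ̂) ≤ ℓ(θ) for all θ ∈ Θ_∞. -/

import Mathlib

open Finset

/-- The sigmoid (logistic) function `σ(x) = 1/(1+e^{-x})`. -/
noncomputable def sigmoid (x : ℝ) : ℝ := 1 / (1 + Real.exp (-x))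

/-- Probability that `Binomial(k, p) = w`. -/
noncomputable def binomProb (k : ℕ) (p : ℝ) (w : ℕ) : ℝ :=
  (k.choose w : ℝ) * p ^ w * (1 - p) ^ (k - w)

/-- Sample space for the league format: for each pair `i < j`, the number of wins
of item `i` over item `j` among the `k` comparisons of that pair. -/
abbrev BTLOutcome (d k : ℕ) := {q : Fin d × Fin d // q.1 < q.2} → Fin (k + 1)

/-- Joint probability of an outcome: independent `Binomial(k, σ(θ_i - θ_j))`
win counts across the pairs `i < j`. -/
noncomputable def outcomeProb (d k : ℕ) (θ : Fin d → ℝ) (w : BTLOutcome d k) : ℝ :=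
  ∏ q : {q : Fin d × Fin d // q.1 < q.2},
    binomProb k (sigmoid (θ q.1.1 - θ q.1.2)) (w q : ℕ)

/-- The full win-count matrix `W_ij` determined by an outcome (`W_ji = k - W_ij`). -/
def winCount (d k : ℕ) (w : BTLOutcome d k) (i j : Fin d) : ℕ :=
  if h : i < j then (w ⟨(i, j), h⟩ : ℕ)
  else if h' : j < i then k - (w ⟨(j, i), h'⟩ : ℕ)
  else 0

/-- The observed fraction of wins `μ_ij = W_ij / k`. -/
noncomputable def winFrac (d k : ℕ) (w : BTLOutcome d k) (i j : Fin d) : ℝ :=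
  (winCount d k w i j : ℝ) / (k : ℝ)

/-- The negative log-likelihood
`ℓ(θ) = k ∑_{i<j} [log(e^{θ_i}+e^{θ_j}) - μ_ij θ_i - μ_ji θ_j]`. -/
noncomputable def nll (d k : ℕ) (μ : Fin d → Fin d → ℝ) (θ : Fin d → ℝ) : ℝ :=
  (k : ℝ) * ∑ i : Fin d, ∑ j : Fin d,
    if i < j then
      Real.log (Real.exp (θ i) + Real.exp (θ j)) - μ i j * θ i - μ j i * θ j
    else 0

/-- The parameter domain `Θ_B = {θ : ‖θ‖_∞ ≤ B, ∑ θ_i = 0}`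
(the norm on `Fin d → ℝ` is the sup norm). -/
def paramSet (d : ℕ) (B : ℝ) : Set (Fin d → ℝ) :=
  {θ | ‖θ‖ ≤ B ∧ ∑ i, θ i = 0}

/-- The expectation (under true parameter `θ*`) of an estimator. -/
noncomputable def expVec (d k : ℕ) (θstar : Fin d → ℝ)
    (est : BTLOutcome d k → Fin d → ℝ) : Fin d → ℝ :=
  fun m => ∑ w : BTLOutcome d k, outcomeProb d k θstar w * est w m

/-- The softplus function `x ↦ log (1 + e^x)`. -/
noncomputable def softplus (x : ℝ) : ℝ := Real.log (1 + Real.exp x)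

lemma softplus_pos (x : ℝ) : 0 < softplus x :=
  Real.log_pos (by linarith [Real.exp_pos x])

lemma le_softplus (x : ℝ) : x ≤ softplus x := by
  rw [softplus, Real.le_log_iff_exp_le (by positivity)]
  linarith

lemma continuous_softplus : Continuous softplus :=
  (continuous_const.add Real.continuous_exp).log fun x =>
    (by positivity : (0 : ℝ) < 1 + Real.exp x).ne'

lemma log_exp_add_exp (a b : ℝ) :
    Real.log (Real.exp a + Real.exp b) = a + softplus (b - a) := by
  rw [softplus, ← Real.log_exp a, ← Real.log_mul (by positivity) (by positivity), Real.log_exp,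
    mul_add, ← Real.exp_add]
  simp

lemma two_mul_softplus_midpoint_lt {x y : ℝ} (h : x ≠ y) :
    2 * softplus ((x + y) / 2) < softplus x + softplus y := by
  have hne : Real.exp (x / 2) ≠ Real.exp (y / 2) := fun H => h (by
    have := Real.exp_injective H
    linarith)
  have hx : Real.exp x = Real.exp (x / 2) ^ 2 := by
    rw [← Real.exp_nat_mul]; congr 1; push_cast; ring
  have hy : Real.exp y = Real.exp (y / 2) ^ 2 := by
    rw [← Real.exp_nat_mul]; congr 1; push_cast; ring
  have hm : Real.exp ((x + y) / 2) = Real.exp (x / 2) * Real.exp (y / 2) := by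
    rw [← Real.exp_add]; congr 1; ring
  have key : (1 + Real.exp ((x + y) / 2)) ^ 2 < (1 + Real.exp x) * (1 + Real.exp y) := by
    rw [hx, hy, hm]
    nlinarith [sq_pos_of_ne_zero (sub_ne_zero.mpr hne)]
  calc 2 * softplus ((x + y) / 2) = Real.log ((1 + Real.exp ((x + y) / 2)) ^ 2) := by
        rw [Real.log_pow, softplus]; norm_num
    _ < Real.log ((1 + Real.exp x) * (1 + Real.exp y)) := Real.log_lt_log (by positivity) key
    _ = softplus x + softplus y := Real.log_mul (by positivity) (by positivity)

lemma two_mul_softplus_midpoint_le (x y : ℝ) :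
    2 * softplus ((x + y) / 2) ≤ softplus x + softplus y := by
  rcases eq_or_ne x y with rfl | h
  · rw [add_self_div_two, two_mul]
  · exact (two_mul_softplus_midpoint_lt h).le

lemma sum_sum_eq_sum_sum_lt {ι : Type*} [Fintype ι] [LinearOrder ι] (a : ι → ι → ℝ)
    (ha : ∀ i, a i i = 0) :
    ∑ i, ∑ j, a i j = ∑ i, ∑ j, if i < j then a i j + a j i else 0 := by
  have h1 : ∀ i j, a i j = (if i < j then a i j else 0) + (if j < i then a i j else 0) := by
    intro i j
    rcases lt_trichotomy i j with h | rfl | h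
    · simp [h, h.not_gt]
    · simp [ha]
    · simp [h, h.not_gt]
  have h2 : ∀ i j, (if i < j then a i j + a j i else 0)
      = (if i < j then a i j else 0) + (if i < j then a j i else 0) := by
    intro i j; split_ifs <;> simp
  simp_rw [h2]
  conv_lhs => enter [2, i, 2, j]; rw [h1]
  simp_rw [Finset.sum_add_distrib]
  congr 1
  exact Finset.sum_comm

lemma winCount_self (d k : ℕ) (w : BTLOutcome d k) (i : Fin d) : winCount d k w i i = 0 := by
  simp [winCount]

lemma winCount_add_winCount (d k : ℕ) (w : BTLOutcome d k) {i j : Fin d} (h : i < j) :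
    winCount d k w i j + winCount d k w j i = k := by
  have := (w ⟨(i, j), h⟩).isLt
  simp only [winCount, h, h.not_gt, dite_true, dite_false]
  omega

lemma nll_winFrac_eq {d k : ℕ} (hk : 1 ≤ k) (w : BTLOutcome d k) (θ : Fin d → ℝ) :
    nll d k (winFrac d k w) θ
      = ∑ i, ∑ j, (winCount d k w i j : ℝ) * softplus (θ j - θ i) := by
  have hk' : (k : ℝ) ≠ 0 := by positivity
  rw [sum_sum_eq_sum_sum_lt _ (by simp [winCount_self]), nll]
  simp_rw [Finset.mul_sum]
  refine Finset.sum_congr rfl fun i _ => Finset.sum_congr rfl fun j _ => ?_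
  split_ifs with h
  · have hW : (winCount d k w i j : ℝ) + winCount d k w j i = k := by
      exact_mod_cast winCount_add_winCount d k w h
    have h1 := log_exp_add_exp (θ i) (θ j)
    have h2 := log_exp_add_exp (θ j) (θ i)
    rw [add_comm] at h2
    rw [show softplus (θ j - θ i) = Real.log (Real.exp (θ i) + Real.exp (θ j)) - θ i by linarith,
      show softplus (θ i - θ j) = Real.log (Real.exp (θ i) + Real.exp (θ j)) - θ j by linarith,
      winFrac, winFrac]
    field_simp
    rw [← hW]
    ring
  · simp

lemma eq_univ_of_closed {ι : Type*} [Fintype ι] {R : ι → ι → Prop}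
    (hR : ∀ S : Finset ι, S.Nonempty → S ≠ univ → ∃ i ∈ S, ∃ j ∉ S, R i j)
    {P : ι → Prop} {i : ι} (hi : P i) (hP : ∀ a b, P a → R a b → P b) (j : ι) : P j := by
  classical
  by_contra hj
  obtain ⟨a, ha, b, hb, hab⟩ := hR (univ.filter P) ⟨i, by simpa using hi⟩
    fun h => hj (by simpa using (Finset.ext_iff.mp h j).mpr (mem_univ j))
  simp only [mem_filter, mem_univ, true_and] at ha hb
  exact hb (hP a b ha hab)

/-- Weighted sums of softplus differences, with weights supported on a strongly connected
digraph, have a unique minimizer on the hyperplane of zero-sum vectors. -/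
lemma existsUnique_minimizer {ι : Type*} [Fintype ι] [Nonempty ι] (W : ι → ι → ℝ)
    (hW0 : ∀ i j, 0 ≤ W i j)
    (hW : ∀ S : Finset ι, S.Nonempty → S ≠ univ → ∃ i ∈ S, ∃ j ∉ S, 0 < W i j) :
    ∃! t : ι → ℝ, (∑ i, t i = 0) ∧ ∀ θ : ι → ℝ, (∑ i, θ i = 0) →
      ∑ i, ∑ j, W i j * softplus (t j - t i) ≤ ∑ i, ∑ j, W i j * softplus (θ j - θ i) := by
  set f : (ι → ℝ) → ℝ := fun θ => ∑ i, ∑ j, W i j * softplus (θ j - θ i) with hf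
  have hfc : Continuous f := by
    refine continuous_finsetSum _ fun i _ => continuous_finsetSum _ fun j _ => ?_
    exact continuous_const.mul (continuous_softplus.comp (by fun_prop))
  have hterm : ∀ θ : ι → ℝ, ∀ i j, 0 ≤ W i j * softplus (θ j - θ i) :=
    fun θ i j => mul_nonneg (hW0 i j) (softplus_pos _).le
  have hle : ∀ θ : ι → ℝ, ∀ i j, W i j * softplus (θ j - θ i) ≤ f θ := fun θ i j =>
    (Finset.single_le_sum (f := fun j => W i j * softplus (θ j - θ i))
      (fun j _ => hterm θ i j) (mem_univ j)).trans
      (Finset.single_le_sum (f := fun i => ∑ j, W i j * softplus (θ j - θ i))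
        (fun i _ => Finset.sum_nonneg fun j _ => hterm θ i j) (mem_univ i))
  have hexists : ∃ t : ι → ℝ, (∑ i, t i = 0) ∧ ∀ θ : ι → ℝ, (∑ i, θ i = 0) → f t ≤ f θ := by
    set K : Set (ι → ℝ) := {θ | ∑ i, θ i = 0 ∧ f θ ≤ f 0} with hK
    have hdiff : ∀ i j, ∃ C : ℝ, ∀ θ ∈ K, θ j - θ i ≤ C := by
      intro i
      refine eq_univ_of_closed hW (i := i) ⟨0, by simp⟩ ?_
      rintro a b ⟨C, hC⟩ hab
      refine ⟨C + f 0 / W a b, fun θ hθ => ?_⟩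
      have h1 : θ b - θ a ≤ f 0 / W a b := by
        rw [le_div_iff₀ hab, mul_comm]
        exact (mul_le_mul_of_nonneg_left (le_softplus _) hab.le).trans ((hle θ a b).trans hθ.2)
      linarith [hC θ hθ]
    choose C hC using hdiff
    have hcard : (0 : ℝ) < Fintype.card ι := by exact_mod_cast Fintype.card_pos
    have hbox : K ⊆ Set.Icc (fun j => -(∑ i, C j i) / Fintype.card ι)
        (fun j => (∑ i, C i j) / Fintype.card ι) := by
      intro θ hθ
      have hs : ∀ j, ∑ i, (θ j - θ i) = Fintype.card ι * θ j := by
        intro j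
        rw [Finset.sum_sub_distrib, hθ.1]
        simp
      refine ⟨fun j => ?_, fun j => ?_⟩
      · have : ∑ i, (θ i - θ j) ≤ ∑ i, C j i := Finset.sum_le_sum fun i _ => hC j i θ hθ
        have h2 : ∑ i, (θ i - θ j) = -∑ i, (θ j - θ i) := by
          rw [← Finset.sum_neg_distrib]; simp
        rw [h2, hs] at this
        rw [div_le_iff₀ hcard]
        linarith
      · have : ∑ i, (θ j - θ i) ≤ ∑ i, C i j := Finset.sum_le_sum fun i _ => hC i j θ hθ
        rw [hs] at this
        rw [le_div_iff₀ hcard]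
        linarith
    have hKclosed : IsClosed K :=
      (isClosed_eq (continuous_finsetSum _ fun i _ => continuous_apply i) continuous_const).inter
        (isClosed_le hfc continuous_const)
    have hKc : IsCompact K := isCompact_Icc.of_isClosed_subset hKclosed hbox
    obtain ⟨t, ht, hmin⟩ := hKc.exists_isMinOn ⟨0, by simp [hK]⟩ hfc.continuousOn
    refine ⟨t, ht.1, fun θ hθ => ?_⟩
    rcases le_total (f θ) (f 0) with h | h
    · exact hmin ⟨hθ, h⟩
    · exact ht.2.trans h
  obtain ⟨t, ht0, htmin⟩ := hexists
  refine ⟨t, ⟨ht0, htmin⟩, ?_⟩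
  rintro u ⟨hu0, humin⟩
  have hmid0 : ∑ i, (t i + u i) / 2 = 0 := by
    rw [← Finset.sum_div, Finset.sum_add_distrib, ht0, hu0]; simp
  have h1 := htmin _ hmid0
  have h2 := humin _ hmid0
  set m : ι → ℝ := fun i => (t i + u i) / 2 with hm
  have hgap : ∀ i j, 0 ≤ W i j * softplus (t j - t i) + W i j * softplus (u j - u i)
      - 2 * (W i j * softplus (m j - m i)) := by
    intro i j
    have := mul_le_mul_of_nonneg_left
      (two_mul_softplus_midpoint_le (t j - t i) (u j - u i)) (hW0 i j)
    rw [show (t j - t i + (u j - u i)) / 2 = m j - m i by simp only [hm]; ring] at this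
    linarith
  have hsum : ∑ i, ∑ j, (W i j * softplus (t j - t i) + W i j * softplus (u j - u i)
      - 2 * (W i j * softplus (m j - m i))) ≤ 0 := by
    simp_rw [Finset.sum_sub_distrib, Finset.sum_add_distrib, ← Finset.mul_sum]
    change f t + f u - 2 * f m ≤ 0
    change f t ≤ f m at h1
    change f u ≤ f m at h2
    linarith
  have hedge : ∀ i j, 0 < W i j → t j - t i = u j - u i := by
    intro i j hij
    by_contra hne
    have h3 := mul_lt_mul_of_pos_left (two_mul_softplus_midpoint_lt hne) hij
    rw [show (t j - t i + (u j - u i)) / 2 = m j - m i by simp only [hm]; ring] at h3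
    have h4 := (Finset.single_le_sum (fun j _ => hgap i j) (mem_univ j)).trans
      ((Finset.single_le_sum (fun i _ => Finset.sum_nonneg fun j _ => hgap i j)
        (mem_univ i)).trans hsum)
    linarith
  funext j
  have hconst : ∀ i, u i - t i = u j - t j :=
    eq_univ_of_closed hW (i := j) rfl fun a b ha hab => by linarith [hedge a b hab]
  have hz : ∑ i, (u i - t i) = 0 := by rw [Finset.sum_sub_distrib, hu0, ht0, sub_zero]
  simp_rw [hconst] at hz
  rw [Finset.sum_const, smul_eq_zero] at hz
  rcases hz with h | h
  · exact absurd h (by simp)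
  · linarith

lemma existsUnique_nll_minimizer {d k : ℕ} (hd : 1 ≤ d) (hk : 1 ≤ k) (w : BTLOutcome d k)
    (hw : ∀ S : Finset (Fin d), S.Nonempty → S ≠ univ →
      ∃ i ∈ S, ∃ j ∉ S, winCount d k w i j ≠ 0) :
    ∃! θhat : Fin d → ℝ, (∑ i, θhat i = 0) ∧ ∀ θ : Fin d → ℝ, (∑ i, θ i = 0) →
      nll d k (winFrac d k w) θhat ≤ nll d k (winFrac d k w) θ := by
  have : Nonempty (Fin d) := ⟨⟨0, hd⟩⟩
  simp_rw [nll_winFrac_eq hk]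
  refine existsUnique_minimizer _ (fun i j => Nat.cast_nonneg _) fun S hS hS' => ?_
  obtain ⟨i, hi, j, hj, h⟩ := hw S hS hS'
  exact ⟨i, hi, j, hj, by exact_mod_cast Nat.pos_of_ne_zero h⟩

lemma sigmoid_pos (x : ℝ) : 0 < sigmoid x := by unfold sigmoid; positivity

lemma sigmoid_lt_one (x : ℝ) : sigmoid x < 1 := by
  rw [sigmoid, div_lt_one (by positivity)]
  linarith [Real.exp_pos (-x)]

lemma one_sub_sigmoid (x : ℝ) : 1 - sigmoid x = sigmoid (-x) := by
  have h : Real.exp (-x) * Real.exp x = 1 := by rw [← Real.exp_add]; simp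
  have := Real.exp_pos x
  have := Real.exp_pos (-x)
  rw [sigmoid, sigmoid, neg_neg]
  field_simp
  linarith

lemma sigmoid_le_sigmoid {x y : ℝ} (h : x ≤ y) : sigmoid x ≤ sigmoid y := by
  unfold sigmoid
  gcongr

lemma binomProb_nonneg {k : ℕ} {p : ℝ} (h0 : 0 ≤ p) (h1 : p ≤ 1) (w : ℕ) :
    0 ≤ binomProb k p w := by
  have : 0 ≤ 1 - p := by linarith
  unfold binomProb
  positivity

lemma sum_binomProb (k : ℕ) (p : ℝ) : ∑ x : Fin (k + 1), binomProb k p x = 1 := by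
  rw [Fin.sum_univ_eq_sum_range (binomProb k p)]
  have := add_pow p (1 - p) k
  rw [add_sub_cancel, one_pow] at this
  rw [this]
  exact Finset.sum_congr rfl fun x _ => by unfold binomProb; ring

lemma outcomeProb_nonneg (d k : ℕ) (θ : Fin d → ℝ) (w : BTLOutcome d k) :
    0 ≤ outcomeProb d k θ w :=
  Finset.prod_nonneg fun _ _ => binomProb_nonneg (sigmoid_pos _).le (sigmoid_lt_one _).le _

lemma sum_outcomeProb (d k : ℕ) (θ : Fin d → ℝ) :
    ∑ w : BTLOutcome d k, outcomeProb d k θ w = 1 := by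
  unfold outcomeProb
  rw [← Fintype.prod_sum (fun (q : {q : Fin d × Fin d // q.1 < q.2}) (x : Fin (k + 1)) =>
    binomProb k (sigmoid (θ q.1.1 - θ q.1.2)) (x : ℕ))]
  simp [sum_binomProb]

open scoped Classical in
lemma card_mul_card_compl_le (d : ℕ) (S : Finset (Fin d)) :
    #S * #Sᶜ ≤ #{q : {q : Fin d × Fin d // q.1 < q.2} | ¬ (q.1.1 ∈ S ↔ q.1.2 ∈ S)} := by
  rw [← Finset.card_product]
  refine Finset.card_le_card_of_surjOn
    (fun q => if q.1.1 ∈ S then (q.1.1, q.1.2) else (q.1.2, q.1.1)) ?_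
  rintro ⟨i, j⟩ hij
  simp only [Finset.coe_product, Set.mem_prod, mem_coe, mem_compl] at hij
  obtain ⟨hi, hj⟩ := hij
  rcases lt_trichotomy i j with h | rfl | h
  · exact ⟨⟨(i, j), h⟩, by simp [hi, hj], by simp [hi]⟩
  · exact absurd hi hj
  · exact ⟨⟨(j, i), h⟩, by simp [hi, hj], by simp [hj]⟩

open scoped Classical in
lemma sum_outcomeProb_no_win_le {d k : ℕ} {θ : Fin d → ℝ} {r : ℝ} (hr1 : r ≤ 1)
    (hr : ∀ i j, sigmoid (θ i - θ j) ≤ r) (S : Finset (Fin d)) :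
    (∑ w : BTLOutcome d k,
      if ∀ i ∈ S, ∀ j ∉ S, winCount d k w i j = 0 then outcomeProb d k θ w else 0)
      ≤ (r ^ k) ^ (#S * #Sᶜ) := by
  rcases S.eq_empty_or_nonempty with rfl | ⟨i₀, -⟩
  · simp [sum_outcomeProb]
  have hr0 : 0 ≤ r := (sigmoid_pos _).le.trans (hr i₀ i₀)
  have hrk0 : 0 ≤ r ^ k := pow_nonneg hr0 k
  have hrk1 : r ^ k ≤ 1 := pow_le_one₀ hr0 hr1
  let Q := {q : Fin d × Fin d // q.1 < q.2}
  let g : Q → Fin (k + 1) → ℝ := fun q x =>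
    if (q.1.1 ∈ S → q.1.2 ∉ S → (x : ℕ) = 0) ∧ (q.1.2 ∈ S → q.1.1 ∉ S → (x : ℕ) = k)
    then binomProb k (sigmoid (θ q.1.1 - θ q.1.2)) x else 0
  have hbp : ∀ (q : Q) (x : Fin (k + 1)), 0 ≤ binomProb k (sigmoid (θ q.1.1 - θ q.1.2)) x :=
    fun q x => binomProb_nonneg (sigmoid_pos _).le (sigmoid_lt_one _).le _
  have hg0 : ∀ q x, 0 ≤ g q x := fun q x => by
    simp only [g]
    split_ifs
    exacts [hbp q x, le_rfl]
  have hpoint : ∀ w : BTLOutcome d k,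
      (if ∀ i ∈ S, ∀ j ∉ S, winCount d k w i j = 0 then outcomeProb d k θ w else 0)
        ≤ ∏ q, g q (w q) := by
    intro w
    split_ifs with h
    · refine (Finset.prod_congr rfl fun q _ => ?_).le
      simp only [g]
      rw [if_pos]
      refine ⟨fun h1 h2 => ?_, fun h1 h2 => ?_⟩
      · have := h _ h1 _ h2
        simpa [winCount, q.2] using this
      · have h3 := h _ h1 _ h2
        have h4 := winCount_add_winCount d k w q.2
        rw [h3, add_zero] at h4
        simpa [winCount, q.2] using h4
    · exact Finset.prod_nonneg fun q _ => hg0 q _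
  have hfactor : ∀ q : Q, ∑ x, g q x ≤ if q.1.1 ∈ S ↔ q.1.2 ∈ S then 1 else r ^ k := by
    intro q
    split_ifs with h
    · rw [← sum_binomProb k (sigmoid (θ q.1.1 - θ q.1.2))]
      refine Finset.sum_le_sum fun x _ => ?_
      simp only [g]
      split_ifs
      exacts [le_rfl, hbp q x]
    · by_cases h1 : q.1.1 ∈ S
      · have h2 : q.1.2 ∉ S := by tauto
        rw [Finset.sum_eq_single 0]
        · simp only [g, h1, h2, binomProb]
          simp only [Fin.val_zero, not_false_eq_true, forall_const, false_imp_iff, and_self,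
            if_true, Nat.choose_zero_right, Nat.cast_one, pow_zero, one_mul, Nat.sub_zero]
          rw [one_sub_sigmoid, neg_sub]
          exact pow_le_pow_left₀ (sigmoid_pos _).le (hr _ _) k
        · intro x _ hx
          simp [g, h1, h2, hx]
        · simp
      · have h2 : q.1.2 ∈ S := by tauto
        rw [Finset.sum_eq_single (Fin.last k)]
        · simp only [g, h1, h2, binomProb]
          simp only [Fin.val_last, not_false_eq_true, forall_const, false_imp_iff, and_self,
            if_true, Nat.choose_self, Nat.cast_one, Nat.sub_self, pow_zero, one_mul, mul_one]
          exact pow_le_pow_left₀ (sigmoid_pos _).le (hr _ _) k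
        · intro x _ hx
          have : (x : ℕ) ≠ k := fun H => hx (Fin.ext H)
          simp [g, h1, h2, this]
        · simp
  calc _ ≤ ∑ w : BTLOutcome d k, ∏ q, g q (w q) := Finset.sum_le_sum fun w _ => hpoint w
    _ = ∏ q, ∑ x, g q x := (Fintype.prod_sum g).symm
    _ ≤ ∏ q : Q, if q.1.1 ∈ S ↔ q.1.2 ∈ S then 1 else r ^ k :=
        Finset.prod_le_prod (fun q _ => Finset.sum_nonneg fun x _ => hg0 q x)
          fun q _ => hfactor q
    _ = (r ^ k) ^ #{q : Q | ¬ (q.1.1 ∈ S ↔ q.1.2 ∈ S)} := by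
        rw [Finset.prod_ite, Finset.prod_const_one, one_mul, Finset.prod_const]
    _ ≤ (r ^ k) ^ (#S * #Sᶜ) := pow_le_pow_of_le_one hrk0 hrk1 (card_mul_card_compl_le d S)

lemma sum_pow_card_nonempty (d : ℕ) (q : ℝ) :
    ∑ S : Finset (Fin d) with S.Nonempty, q ^ #S = (1 + q) ^ d - 1 := by
  have h := Finset.sum_pow_mul_eq_add_pow q 1 (univ : Finset (Fin d))
  simp only [one_pow, mul_one, Finset.powerset_univ, Finset.card_univ, Fintype.card_fin] at h
  have h2 := Finset.sum_filter_add_sum_filter_not univ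
    (fun S : Finset (Fin d) => S.Nonempty) (fun S => q ^ #S)
  rw [h, add_comm q 1] at h2
  rw [← h2]
  simp [Finset.not_nonempty_iff_eq_empty, Finset.filter_eq']

lemma sum_pow_card_mul_card_compl_le (d : ℕ) {s : ℝ} (hs0 : 0 ≤ s) (hs1 : s ≤ 1) :
    ∑ S : Finset (Fin d) with S.Nonempty ∧ S ≠ univ, (s ^ 2) ^ (#S * #Sᶜ)
      ≤ 2 * ((1 + s ^ d) ^ d - 1) := by
  have hcompl : ∑ S : Finset (Fin d) with S ≠ univ, (s ^ d) ^ #Sᶜ = (1 + s ^ d) ^ d - 1 := by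
    rw [← sum_pow_card_nonempty]
    refine Finset.sum_nbij' compl compl ?_ ?_ ?_ ?_ ?_ <;>
      simp [Finset.nonempty_iff_ne_empty]
  have hbound : ∀ S : Finset (Fin d), (s ^ 2) ^ (#S * #Sᶜ) ≤ (s ^ d) ^ #S + (s ^ d) ^ #Sᶜ := by
    intro S
    have hc : #S + #Sᶜ = d := by simp
    rw [← pow_mul, ← pow_mul, ← pow_mul]
    rcases le_total (#S) (#Sᶜ) with h | h
    · refine (pow_le_pow_of_le_one hs0 hs1 ?_).trans (le_add_of_nonneg_right (by positivity))
      calc d * #S = (#S + #Sᶜ) * #S := by rw [hc]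
        _ ≤ 2 * (#S * #Sᶜ) := by nlinarith
    · refine (pow_le_pow_of_le_one hs0 hs1 ?_).trans (le_add_of_nonneg_left (by positivity))
      calc d * #Sᶜ = (#S + #Sᶜ) * #Sᶜ := by rw [hc]
        _ ≤ 2 * (#S * #Sᶜ) := by nlinarith
  calc _ ≤ ∑ S : Finset (Fin d) with S.Nonempty ∧ S ≠ univ, ((s ^ d) ^ #S + (s ^ d) ^ #Sᶜ) :=
        Finset.sum_le_sum fun S _ => hbound S
    _ ≤ ∑ S : Finset (Fin d) with S.Nonempty, (s ^ d) ^ #S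
        + ∑ S : Finset (Fin d) with S ≠ univ, (s ^ d) ^ #Sᶜ := by
        rw [Finset.sum_add_distrib]
        refine add_le_add ?_ ?_ <;>
        · refine Finset.sum_le_sum_of_subset_of_nonneg ?_ fun _ _ _ => by positivity
          intro S
          simp +contextual
    _ = 2 * ((1 + s ^ d) ^ d - 1) := by rw [hcompl, sum_pow_card_nonempty]; ring

open scoped Classical in
/-- Union bound over the sets `S` none of whose members ever beats a non-member. -/
lemma one_sub_le_sum_outcomeProb {d k : ℕ} (hd : 1 ≤ d) (hk : 1 ≤ k) {θ : Fin d → ℝ} {r : ℝ}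
    (hr1 : r ≤ 1) (hr : ∀ i j, sigmoid (θ i - θ j) ≤ r) :
    1 - ∑ S : Finset (Fin d) with S.Nonempty ∧ S ≠ univ, (r ^ k) ^ (#S * #Sᶜ) ≤
      ∑ w : BTLOutcome d k,
        if (∃! θhat : Fin d → ℝ, (∑ i, θhat i = 0) ∧
            ∀ t : Fin d → ℝ, (∑ i, t i = 0) →
              nll d k (winFrac d k w) θhat ≤ nll d k (winFrac d k w) t)
        then outcomeProb d k θ w else 0 := by
  rw [sub_le_iff_le_add, ← sum_outcomeProb d k θ]
  refine le_trans ?_ (add_le_add_right (Finset.sum_le_sum fun S _ =>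
    sum_outcomeProb_no_win_le (k := k) hr1 hr S) _)
  rw [Finset.sum_comm, ← Finset.sum_add_distrib]
  refine Finset.sum_le_sum fun w _ => ?_
  have hp := outcomeProb_nonneg d k θ w
  have hnn : ∀ S : Finset (Fin d),
      0 ≤ if ∀ i ∈ S, ∀ j ∉ S, winCount d k w i j = 0 then outcomeProb d k θ w else 0 := by
    intro S; split_ifs; exacts [hp, le_rfl]
  split_ifs with h
  · exact le_add_of_nonneg_right (Finset.sum_nonneg fun S _ => hnn S)
  · have hbad := mt (existsUnique_nll_minimizer hd hk w) h
    push Not at hbad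
    obtain ⟨S, hS, hS', hz⟩ := hbad
    rw [zero_add]
    refine le_trans ?_ (Finset.single_le_sum (fun S _ => hnn S)
      (Finset.mem_filter.mpr ⟨mem_univ S, hS, hS'⟩))
    rw [if_pos hz]

lemma exists_pow_le_div_sq {s : ℝ} (hs0 : 0 ≤ s) (hs1 : s < 1) :
    ∃ C : ℝ, 1 ≤ C ∧ ∀ n : ℕ, 1 ≤ n → s ^ n ≤ C / (n : ℝ) ^ 2 := by
  obtain ⟨C, hC⟩ := (tendsto_pow_const_mul_const_pow_of_abs_lt_one 2
    (by rwa [abs_of_nonneg hs0] : |s| < 1)).bddAbove_range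
  refine ⟨max C 1, le_max_right _ _, fun n hn => ?_⟩
  rw [le_div_iff₀ (by positivity), mul_comm]
  exact (hC ⟨n, rfl⟩).trans (le_max_left _ _)

open scoped Classical in
/-- Lemma 3: for every `B > 0` there is a constant `c > 0`
depending only on `B` such that for all `d ≥ 2`, `k ≥ 1` and every true parameter
`θ* ∈ Θ_B`, with probability at least `1 − c/(dk)` over the comparison outcomes,
the negative log-likelihood attains a unique minimizer over the hyperplane
`Θ_∞ = {θ : ∑ θ_i = 0}`. -/
theorem unconstrained_mle_exists_unique_whp (B : ℝ) (hB : 0 < B) :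
    ∃ c > (0 : ℝ), ∀ d k : ℕ, 2 ≤ d → 1 ≤ k →
      ∀ θstar ∈ paramSet d B,
        1 - c / ((d : ℝ) * k) ≤
          ∑ w : BTLOutcome d k,
            if (∃! θhat : Fin d → ℝ, (∑ i, θhat i = 0) ∧
                ∀ θ : Fin d → ℝ, (∑ i, θ i = 0) →
                  nll d k (winFrac d k w) θhat ≤ nll d k (winFrac d k w) θ)
            then outcomeProb d k θstar w else 0 := by
  set r := sigmoid (2 * B)
  have hr0 : 0 ≤ r := (sigmoid_pos _).le
  have hr1 : r < 1 := sigmoid_lt_one _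
  obtain ⟨C, hC1, hC⟩ := exists_pow_le_div_sq (Real.sqrt_nonneg r)
    ((Real.sqrt_lt' one_pos).mpr (by simpa using hr1))
  refine ⟨4 * C, by linarith, fun d k hd hk θ hθ => ?_⟩
  have hd' : (1 : ℝ) ≤ d := by exact_mod_cast (by omega : 1 ≤ d)
  have hk' : (1 : ℝ) ≤ k := by exact_mod_cast hk
  have hdk : 0 < (d : ℝ) * k := by positivity
  rcases le_total ((d : ℝ) * k) C with hsmall | hlarge
  · refine le_trans (b := 0) ?_ (Finset.sum_nonneg fun w _ => ?_)
    · rw [sub_nonpos, one_le_div hdk]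
      linarith
    · split_ifs
      exacts [outcomeProb_nonneg d k θ w, le_rfl]
  · have hr : ∀ i j, sigmoid (θ i - θ j) ≤ r := by
      intro i j
      apply sigmoid_le_sigmoid
      have hi := (abs_le.mp ((norm_le_pi_norm θ i).trans hθ.1)).2
      have hj := (abs_le.mp ((norm_le_pi_norm θ j).trans hθ.1)).1
      linarith
    refine le_trans ?_ (one_sub_le_sum_outcomeProb (by omega) hk hr1.le hr)
    refine sub_le_sub_left ?_ 1
    set s := Real.sqrt r ^ k with hs
    have hs0 : 0 ≤ s := by positivity
    have hs1 : s ≤ 1 := pow_le_one₀ (Real.sqrt_nonneg r) (Real.sqrt_le_one.mpr hr1.le)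
    have hrs : r ^ k = s ^ 2 := by rw [hs, pow_right_comm, Real.sq_sqrt hr0]
    rw [hrs]
    refine (sum_pow_card_mul_card_compl_le d hs0 hs1).trans ?_
    have hq0 : 0 ≤ s ^ d := by positivity
    have hq : d * s ^ d ≤ C / (d * k) := by
      have h := hC (d * k) (Nat.mul_pos (by omega) hk)
      rw [mul_comm d k, pow_mul, ← hs] at h
      calc d * s ^ d ≤ d * (C / ((k * d : ℕ) : ℝ) ^ 2) := by gcongr
        _ = C / (d * k) / k := by push_cast; field_simp
        _ ≤ C / (d * k) := div_le_self (by positivity) hk'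
    have hq1 : d * s ^ d ≤ 1 := hq.trans ((div_le_one hdk).mpr hlarge)
    have hexp : (1 + s ^ d) ^ d ≤ Real.exp (d * s ^ d) := by
      rw [Real.exp_nat_mul]
      exact pow_le_pow_left₀ (by positivity) (by linarith [Real.add_one_le_exp (s ^ d)]) d
    have hlin := Real.abs_exp_sub_one_le (x := d * s ^ d)
      (by rwa [abs_of_nonneg (by positivity)])
    rw [abs_of_nonneg (a := d * s ^ d) (by positivity)] at hlin
    have := le_abs_self (Real.exp (d * s ^ d) - 1)
    rw [mul_div_assoc]
    linarith
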